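/- Let V be an infinite-dimensional vector space over a division ring K. Then there is no semigroup embedding from End_fin(V) into the dual of End(V); that is, there is no injective map ε from the finite-rank linear endomorphisms of V to the linear endomorphisms of V satisfying ε(f∘g) = ε(g)∘ε(f) for all finite-rank f, g. -/

import Mathlib

theorem aux_exists_dual_vec {K V ι : Type*} [DivisionRing K] [AddCommGroup V] [Module K V]
    (b : ι → (V →ₗ[K] K)) (hb : LinearIndependent Kᵐᵒᵖ b) (s : Finset ι) (i : ι) (hi : i ∈ s) :
    ∃ v : V, b i v = 1 ∧ ∀ j ∈ s, j ≠ i → b j v = 0 := by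
  classical
  let T : V →ₗ[K] (s → K) := LinearMap.pi fun j => b j
  have hT : LinearMap.range T = ⊤ := by
    by_contra hne
    obtain ⟨f, hf, hk⟩ := Submodule.exists_le_ker_of_lt_top _ (lt_top_iff_ne_top.mpr hne)
    apply hf
    have hs : LinearIndependent Kᵐᵒᵖ (fun j : s => b j) :=
      hb.comp _ Subtype.val_injective
    rw [Fintype.linearIndependent_iff] at hs
    have h0 := hs (fun j => MulOpposite.op (f (Pi.single j 1))) (by
      ext v
      have h1 : f (T v) = 0 := hk ⟨v, rfl⟩
      have h2 : T v = ∑ j : s, (b j v) • (Pi.single j (1 : K) : s → K) := by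
        ext k
        simp [T, Finset.sum_apply, Pi.single_apply]
      rw [h2, map_sum] at h1
      simpa [LinearMap.sum_apply] using h1)
    apply LinearMap.pi_ext'
    intro j
    ext
    have := h0 j
    simpa using this
  obtain ⟨v, hv⟩ : ∃ v, T v = Pi.single ⟨i, hi⟩ 1 := by
    have : (Pi.single ⟨i, hi⟩ 1 : s → K) ∈ LinearMap.range T := hT ▸ Submodule.mem_top
    exact this
  refine ⟨v, ?_, fun j hj hji => ?_⟩
  · have := congrFun hv ⟨i, hi⟩
    simpa [T] using this
  · have := congrFun hv ⟨j, hj⟩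
    simpa [T, Pi.single_apply, hji] using this

/-- For an infinite-dimensional vector space `V` over a division ring
`K`, there is no semigroup embedding from `End_fin(V)` into the dual of `End(V)`. -/
theorem stmt_11 {K V : Type u} [DivisionRing K] [AddCommGroup V] [Module K V]
    (hV : Cardinal.aleph0 ≤ Module.rank K V) :
    ¬∃ ε : {f : V →ₗ[K] V // FiniteDimensional K (LinearMap.range f)} → (V →ₗ[K] V),
      Function.Injective ε ∧
      ∀ f g h : {f : V →ₗ[K] V // FiniteDimensional K (LinearMap.range f)},
        h.1 = f.1 ∘ₗ g.1 → ε h = ε g ∘ₗ ε f := by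
  classical
  rintro ⟨ε, hinj, hmul⟩
  let R : (V →ₗ[K] K) → V → {f : V →ₗ[K] V // FiniteDimensional K (LinearMap.range f)} :=
    fun φ v => ⟨LinearMap.toSpanSingleton K V v ∘ₗ φ, by
      have : FiniteDimensional K (LinearMap.range (LinearMap.toSpanSingleton K V v)) :=
        inferInstance
      exact Submodule.finiteDimensional_of_le (LinearMap.range_comp_le_range _ _)⟩
  let z : {f : V →ₗ[K] V // FiniteDimensional K (LinearMap.range f)} := ⟨0, by
    rw [LinearMap.range_zero]; infer_instance⟩
  let δ : {f : V →ₗ[K] V // FiniteDimensional K (LinearMap.range f)} → (V →ₗ[K] V) :=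
    fun f => ε f - ε z
  have hδ : ∀ f g h : {f : V →ₗ[K] V // FiniteDimensional K (LinearMap.range f)},
        h.1 = f.1 ∘ₗ g.1 → ∀ x, δ g (δ f x) = δ h x := by
    intro f g h hh x
    have h1 := LinearMap.congr_fun (hmul f g h hh) x
    have h2 := LinearMap.congr_fun (hmul z g z (by simp [z])) x
    have h3 := LinearMap.congr_fun (hmul f z z (by simp [z])) x
    have h4 := LinearMap.congr_fun (hmul z z z (by simp [z])) x
    simp only [LinearMap.comp_apply] at h1 h2 h3 h4
    simp only [δ, LinearMap.sub_apply, map_sub, ← h1, ← h2, ← h3, ← h4]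
    abel
  have hδz : δ z = 0 := sub_self _
  have hnt : Nontrivial V := by
    by_contra hn
    rw [not_nontrivial_iff_subsingleton] at hn
    rw [rank_subsingleton'] at hV
    exact absurd hV (not_le.mpr Cardinal.aleph0_pos)
  obtain ⟨v0, hv0⟩ := exists_ne (0 : V)
  obtain ⟨φ0, hφ0⟩ : ∃ φ : V →ₗ[K] K, φ v0 = 1 := by
    obtain ⟨f, hf, -⟩ := Submodule.exists_le_ker_of_notMem
      (K := K) (p := ⊥) (v := v0) (by simpa using hv0)
    exact ⟨LinearMap.toSpanSingleton K K (f v0)⁻¹ ∘ₗ f, by simp [hf]⟩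
  have hp : δ (R φ0 v0) ≠ 0 := by
    intro h
    have h1 := hinj (sub_eq_zero.mp h)
    have h2 := LinearMap.congr_fun (congrArg Subtype.val h1) v0
    simp [R, z, hφ0] at h2
    exact hv0 h2
  obtain ⟨y, hy⟩ : ∃ y, δ (R φ0 v0) y ≠ 0 := by
    by_contra! h
    exact hp (LinearMap.ext h)
  set x := δ (R φ0 v0) y with hx
  have hpx : δ (R φ0 v0) x = x := hδ _ _ _ (by ext w; simp [R, hφ0]) y
  have h1 : ∀ (φ : V →ₗ[K] K) v, φ v = 1 → δ (R φ0 v) (δ (R φ v0) x) = x := by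
    intro φ v h
    rw [hδ (R φ v0) (R φ0 v) (R φ0 v0) (by ext w; simp [R, h]), hpx]
  have h0 : ∀ (φ : V →ₗ[K] K) v, φ v = 0 → δ (R φ0 v) (δ (R φ v0) x) = 0 := by
    intro φ v h
    rw [hδ (R φ v0) (R φ0 v) z (by ext w; simp [R, z, h]), hδz, LinearMap.zero_apply]
  let b := Module.Free.chooseBasis Kᵐᵒᵖ (V →ₗ[K] K)
  have hli : LinearIndependent K (fun i => δ (R (b i) v0) x) := by
    rw [linearIndependent_iff']
    intro s c hc i hi
    obtain ⟨v, hv1, hv2⟩ := aux_exists_dual_vec b b.linearIndependent s i hi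
    have h := congrArg (δ (R φ0 v)) hc
    rw [map_sum, map_zero, Finset.sum_eq_single_of_mem i hi, map_smul, h1 _ _ hv1] at h
    · exact (smul_eq_zero.mp h).resolve_right hy
    · intro j hj hji
      rw [map_smul, h0 _ _ (hv2 j hj hji), smul_zero]
  have hle := hli.cardinal_le_rank
  rw [b.mk_eq_rank''] at hle
  exact absurd hle (not_le.mpr (rank_lt_rank_dual' hV))
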